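/- Let X be a finite set, Λ a set, and d : X → Λ a surjective map. Let W be a subgroup of Sym(X) such that every w ∈ W permutes the fibers of d, with induced homomorphism π : W → Sym(Λ), and assume W contains every fiber-preserving permutation of X, so that K := ker(π) is exactly the group of fiber-preserving permutations. For a family ≤ of linear orders, one for each fiber d⁻¹(λ), let s_≤ : π(W) → W denote the homomorphic section of π sending τ to the permutation restricting to the unique order-preserving bijection d⁻¹(λ) → d⁻¹(τ(λ)) for each λ. Then for any two such families of linear orders ≤ and ≤′, there exists k ∈ K such that s_{≤′}(τ) = k ∘ s_≤(τ) ∘ k⁻¹ for all τ ∈ π(W); that is, the sections constructed from orderings are conjugate by a fiber-preserving permutation. -/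

import Mathlib

theorem aux_exists' {A B : Type*} [Finite A] (o₁ : LinearOrder A) (o₂ : LinearOrder B)
    (f : A ≃ B) : ∃ e : A ≃ B, ∀ x y, o₁.lt x y → o₂.lt (e x) (e y) := by
  have := Fintype.ofFinite A
  have := Fintype.ofEquiv A f
  let e := (Fintype.orderIsoFinOfCardEq A (Fintype.card_congr f)).symm.trans
    (Fintype.orderIsoFinOfCardEq B rfl)
  exact ⟨e.toEquiv, fun x y h => e.lt_iff_lt.2 h⟩

theorem aux_exists {A : Type*} [Finite A] (o₁ o₂ : LinearOrder A) :
    ∃ e : A ≃ A, ∀ x y, o₁.lt x y → o₂.lt (e x) (e y) :=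
  aux_exists' o₁ o₂ (Equiv.refl A)

theorem aux_unique {A B : Type*} [Finite A] (o₁ : LinearOrder A) (o₂ : LinearOrder B)
    (f g : A ≃ B) (hf : ∀ x y, o₁.lt x y → o₂.lt (f x) (f y))
    (hg : ∀ x y, o₁.lt x y → o₂.lt (g x) (g y)) (x : A) : f x = g x := by
  haveI : Finite B := Finite.of_equiv A f
  have hf' : StrictMono f := fun x y h => hf x y h
  have hg' : StrictMono g := fun x y h => hg x y h
  have := Subsingleton.elim (hf'.orderIsoOfSurjective f f.surjective)
    (hg'.orderIsoOfSurjective g g.surjective)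
  exact congrArg (fun e : A ≃o B => e x) this

/-- With `d : X → Λ`, `W`, `π` as before (`W` containing all fiber-preserving permutations, so
that `ker π` is exactly the group of fiber-preserving permutations), suppose `s₁` and `s₂`
are the homomorphic sections of `π` built from two families `ord₁`, `ord₂` of linear orders
on the fibers of `d` (each `sᵢ(τ)` restricts, fiber by fiber, to the unique
`ordᵢ`-order-preserving bijection `d⁻¹(λ) → d⁻¹(τ(λ))`, expressed via strict
monotonicity).  Then there is a fiber-preserving element `k ∈ K = ker π` with
`s₂(τ) = k ∘ s₁(τ) ∘ k⁻¹` for all `τ ∈ π(W)`. -/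
theorem toric_weyl_sections_conjugate
    {X Λ : Type*} [Finite X] (d : X → Λ) (hd : Function.Surjective d)
    (W : Subgroup (Equiv.Perm X)) (π : W →* Equiv.Perm Λ)
    (hπ : ∀ (w : W) (x : X), d ((w : Equiv.Perm X) x) = π w (d x))
    (hfull : ∀ σ : Equiv.Perm X, (∀ x : X, d (σ x) = d x) → σ ∈ W)
    (ord₁ ord₂ : ∀ l : Λ, LinearOrder {x : X // d x = l})
    (s₁ s₂ : π.range →* W)
    (hs₁ : ∀ τ : π.range, π (s₁ τ) = (τ : Equiv.Perm Λ))
    (hs₂ : ∀ τ : π.range, π (s₂ τ) = (τ : Equiv.Perm Λ))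
    (hmono₁ : ∀ (τ : π.range) (l : Λ) (x y : X) (hx : d x = l) (hy : d y = l)
      (hx' : d (((s₁ τ : W) : Equiv.Perm X) x) = (τ : Equiv.Perm Λ) l)
      (hy' : d (((s₁ τ : W) : Equiv.Perm X) y) = (τ : Equiv.Perm Λ) l),
      (ord₁ l).lt ⟨x, hx⟩ ⟨y, hy⟩ →
        (ord₁ ((τ : Equiv.Perm Λ) l)).lt ⟨_, hx'⟩ ⟨_, hy'⟩)
    (hmono₂ : ∀ (τ : π.range) (l : Λ) (x y : X) (hx : d x = l) (hy : d y = l)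
      (hx' : d (((s₂ τ : W) : Equiv.Perm X) x) = (τ : Equiv.Perm Λ) l)
      (hy' : d (((s₂ τ : W) : Equiv.Perm X) y) = (τ : Equiv.Perm Λ) l),
      (ord₂ l).lt ⟨x, hx⟩ ⟨y, hy⟩ →
        (ord₂ ((τ : Equiv.Perm Λ) l)).lt ⟨_, hx'⟩ ⟨_, hy'⟩) :
    ∃ k : W, k ∈ π.ker ∧ ∀ τ : π.range, s₂ τ = k * s₁ τ * k⁻¹ := by
  choose e he using fun l => aux_exists (ord₁ l) (ord₂ l)
  have cast : ∀ (l : Λ) (x : X) (hx : d x = l), (e (d x) ⟨x, rfl⟩ : X) = e l ⟨x, hx⟩ := by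
    rintro l x rfl; rfl
  have cast' : ∀ (l : Λ) (x : X) (hx : d x = l),
      ((e (d x)).symm ⟨x, rfl⟩ : X) = (e l).symm ⟨x, hx⟩ := by
    rintro l x rfl; rfl
  let k₀ : Equiv.Perm X :=
    { toFun := fun x => (e (d x) ⟨x, rfl⟩ : X)
      invFun := fun x => ((e (d x)).symm ⟨x, rfl⟩ : X)
      left_inv := fun x => by
        change ((e (d (e (d x) ⟨x, rfl⟩ : X))).symm ⟨(e (d x) ⟨x, rfl⟩ : X), rfl⟩ : X) = x
        rw [cast' (d x) _ (e (d x) ⟨x, rfl⟩).2]; simp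
      right_inv := fun x => by
        change ((e (d ((e (d x)).symm ⟨x, rfl⟩ : X))) ⟨((e (d x)).symm ⟨x, rfl⟩ : X), rfl⟩ : X) = x
        rw [cast (d x) _ ((e (d x)).symm ⟨x, rfl⟩).2]; simp }
  have hk₀ : ∀ x, d (k₀ x) = d x := fun x => (e (d x) ⟨x, rfl⟩).2
  let k : W := ⟨k₀, hfull k₀ hk₀⟩
  refine ⟨k, ?_, fun τ => ?_⟩
  · rw [MonoidHom.mem_ker]
    ext l
    obtain ⟨x, rfl⟩ := hd l
    rw [← hπ]
    exact hk₀ x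
  · rw [eq_mul_inv_iff_mul_eq]
    ext x
    have h₁ : ∀ x, d ((s₁ τ : Equiv.Perm X) x) = (τ : Equiv.Perm Λ) (d x) := fun x => by
      rw [hπ, hs₁]
    have h₂ : ∀ x, d ((s₂ τ : Equiv.Perm X) x) = (τ : Equiv.Perm Λ) (d x) := fun x => by
      rw [hπ, hs₂]
    let S₁ : {y : X // d y = d x} ≃ {y : X // d y = (τ : Equiv.Perm Λ) (d x)} :=
      (s₁ τ : Equiv.Perm X).subtypeEquiv fun a => by rw [h₁]; simp
    let S₂ : {y : X // d y = d x} ≃ {y : X // d y = (τ : Equiv.Perm Λ) (d x)} :=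
      (s₂ τ : Equiv.Perm X).subtypeEquiv fun a => by rw [h₂]; simp
    have key := aux_unique (ord₁ (d x)) (ord₂ ((τ : Equiv.Perm Λ) (d x)))
      ((e (d x)).trans S₂) (S₁.trans (e _))
      (fun a b h => hmono₂ τ (d x) _ _ _ _ (S₂ _).2 (S₂ _).2 (he _ _ _ h))
      (fun a b h => he _ _ _ (hmono₁ τ (d x) _ _ _ _ (S₁ _).2 (S₁ _).2 h)) ⟨x, rfl⟩
    have key' := congrArg Subtype.val key
    change (s₂ τ : Equiv.Perm X) (e (d x) ⟨x, rfl⟩ : X)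
      = (e (d ((s₁ τ : Equiv.Perm X) x)) ⟨(s₁ τ : Equiv.Perm X) x, rfl⟩ : X)
    rw [cast _ _ (h₁ x)]
    exact key'
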